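/- arXiv:1409.4857 — 10 statements merged into one kernel-verified Lean document; each statement's English description precedes it below -/
import Mathlib

section
/- Let a, b, λ > 0 with 1 - 4ab > 0, let 0 < x₁ < x₂ be the two distinct real roots of a X² - X + b, and set ρ₀ = λ⁻¹ log x₁ and ρ₁ = λ⁻¹ log x₂. Then a function F : ℝ → ℝ satisfies a F(x+λ) - F(x) + b F(x-λ) = 0 for all x ∈ ℝ if and only if there exist functions L₀, L₁ : ℝ → ℝ with L₀(t+1) = L₀(t) and L₁(t+1) = L₁(t) for all t, such that F(x) = e^{ρ₀ x} L₀(x/λ) + e^{ρ₁ x} L₁(x/λ) for all x ∈ ℝ. -/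
/-- The exponential with rate `lam⁻¹ * log r` is multiplied by `r` under translation by `lam`. -/
lemma exp_rate_mul_add {lam r : ℝ} (hlam : lam ≠ 0) (hr : 0 < r) (x : ℝ) :
    Real.exp (lam⁻¹ * Real.log r * (x + lam)) = r * Real.exp (lam⁻¹ * Real.log r * x) := by
  have h : lam⁻¹ * Real.log r * (x + lam) = Real.log r + lam⁻¹ * Real.log r * x := by
    field_simp
    ring
  rw [h, Real.exp_add, Real.exp_log hr]

/-- The solutions of `H (x + lam) = r * H x` are the exponentials of rate `lam⁻¹ * log r`
modulated by a periodic function. -/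
lemma forall_add_eq_mul_iff_exists_periodic {lam r : ℝ} (hlam : lam ≠ 0) (hr : 0 < r)
    (H : ℝ → ℝ) :
    (∀ x, H (x + lam) = r * H x) ↔
      ∃ L : ℝ → ℝ, (∀ t, L (t + 1) = L t) ∧
        ∀ x, H x = Real.exp (lam⁻¹ * Real.log r * x) * L (x / lam) := by
  constructor
  · intro hH
    refine ⟨fun t => H (lam * t) / Real.exp (lam⁻¹ * Real.log r * (lam * t)), fun t => ?_,
      fun x => ?_⟩
    · simp only [mul_add, mul_one lam]
      rw [hH, ← mul_add, exp_rate_mul_add hlam hr, mul_div_mul_left _ _ hr.ne']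
    · simp only [mul_div_cancel₀ x hlam]
      rw [mul_div_cancel₀ _ (Real.exp_ne_zero _)]
  · rintro ⟨L, hL, hH⟩ x
    rw [hH, hH x, exp_rate_mul_add hlam hr, add_div, div_self hlam, hL, mul_assoc]


theorem stmt_3 (a b lam x₁ x₂ ρ₀ ρ₁ : ℝ) (ha : 0 < a) (hb : 0 < b) (hlam : 0 < lam)
    (hΔ : 0 < 1 - 4 * (a * b)) (hx₁ : 0 < x₁) (hlt : x₁ < x₂)
    (hroot₁ : a * x₁ ^ 2 - x₁ + b = 0) (hroot₂ : a * x₂ ^ 2 - x₂ + b = 0)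
    (hρ₀ : ρ₀ = lam⁻¹ * Real.log x₁) (hρ₁ : ρ₁ = lam⁻¹ * Real.log x₂)
    (F : ℝ → ℝ) :
    (∀ x : ℝ, a * F (x + lam) - F x + b * F (x - lam) = 0) ↔
      ∃ L₀ L₁ : ℝ → ℝ, (∀ t, L₀ (t + 1) = L₀ t) ∧ (∀ t, L₁ (t + 1) = L₁ t) ∧
        ∀ x : ℝ, F x = Real.exp (ρ₀ * x) * L₀ (x / lam)
          + Real.exp (ρ₁ * x) * L₁ (x / lam) := by
  have hne : x₂ - x₁ ≠ 0 := (sub_pos.mpr hlt).ne'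
  have hx₂ : 0 < x₂ := hx₁.trans hlt
  have hsum : a * (x₁ + x₂) = 1 := mul_left_cancel₀ hne (by linear_combination hroot₂ - hroot₁)
  have hprod : b = a * (x₁ * x₂) := by linear_combination hroot₁ - x₁ * hsum
  subst hρ₀ hρ₁
  constructor
  · intro hF
    have hrec (x : ℝ) : F (x + lam + lam) = (x₁ + x₂) * F (x + lam) - x₁ * x₂ * F x := by
      have h := hF (x + lam)
      rw [add_sub_cancel_right] at h
      refine mul_left_cancel₀ ha.ne' ?_
      linear_combination h - F (x + lam) * hsum - F x * hprod
    obtain ⟨L₀, hL₀, h₀⟩ := (forall_add_eq_mul_iff_exists_periodic hlam.ne' hx₁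
      fun x => (x₂ * F x - F (x + lam)) / (x₂ - x₁)).mp fun x => by
        rw [hrec]
        ring
    obtain ⟨L₁, hL₁, h₁⟩ := (forall_add_eq_mul_iff_exists_periodic hlam.ne' hx₂
      fun x => (F (x + lam) - x₁ * F x) / (x₂ - x₁)).mp fun x => by
        rw [hrec]
        ring
    refine ⟨L₀, L₁, hL₀, hL₁, fun x => ?_⟩
    rw [← h₀, ← h₁]
    field_simp
    ring
  · rintro ⟨L₀, L₁, hL₀, hL₁, hF⟩ x
    have h₀ := (forall_add_eq_mul_iff_exists_periodic hlam.ne' hx₁ _).mpr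
      ⟨L₀, hL₀, fun _ => rfl⟩
    have h₁ := (forall_add_eq_mul_iff_exists_periodic hlam.ne' hx₂ _).mpr
      ⟨L₁, hL₁, fun _ => rfl⟩
    have h₀x := h₀ (x - lam)
    have h₁x := h₁ (x - lam)
    rw [sub_add_cancel] at h₀x h₁x
    rw [hF, hF x, hF (x - lam), h₀ x, h₁ x, h₀x, h₁x]
    linear_combination
      Real.exp (lam⁻¹ * Real.log x₁ * (x - lam)) * L₀ ((x - lam) / lam) * hroot₁ +
        Real.exp (lam⁻¹ * Real.log x₂ * (x - lam)) * L₁ ((x - lam) / lam) * hroot₂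
end

section
/- Let λ > 0, c ≠ 0 be real numbers and let L : ℝ → ℝ satisfy L(t+1) = L(t) for all t. A function G : ℝ → ℝ satisfies G(x+λ) - G(x) = e^{cx} L(x/λ) for all x ∈ ℝ if and only if there is a function M : ℝ → ℝ with M(t+1) = M(t) for all t such that G(x) = (e^{cx}/(e^{cλ} - 1)) L(x/λ) + M(x/λ) for all x ∈ ℝ. -/
theorem stmt_4 (lam c : ℝ) (hlam : 0 < lam) (hc : c ≠ 0)
    (L : ℝ → ℝ) (hL : ∀ t, L (t + 1) = L t) (G : ℝ → ℝ) :
    (∀ x : ℝ, G (x + lam) - G x = Real.exp (c * x) * L (x / lam)) ↔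
      ∃ M : ℝ → ℝ, (∀ t, M (t + 1) = M t) ∧
        ∀ x : ℝ, G x = Real.exp (c * x) / (Real.exp (c * lam) - 1) * L (x / lam)
          + M (x / lam) := by
  have hl : lam ≠ 0 := hlam.ne'
  have hE : Real.exp (c * lam) - 1 ≠ 0 := by
    rw [sub_ne_zero, Ne, Real.exp_eq_one_iff]
    exact mul_ne_zero hc hl
  have hexp (x : ℝ) : Real.exp (c * (x + lam)) = Real.exp (c * x) * Real.exp (c * lam) := by
    rw [mul_add, Real.exp_add]
  have hdiv (x : ℝ) : (x + lam) / lam = x / lam + 1 := by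
    rw [add_div, div_self hl]
  have hstep (x : ℝ) :
      Real.exp (c * (x + lam)) / (Real.exp (c * lam) - 1) * L ((x + lam) / lam)
        - Real.exp (c * x) / (Real.exp (c * lam) - 1) * L (x / lam)
        = Real.exp (c * x) * L (x / lam) := by
    rw [hexp, hdiv, hL]
    field_simp
  constructor
  · intro h
    refine ⟨fun t => G (lam * t)
      - Real.exp (c * (lam * t)) / (Real.exp (c * lam) - 1) * L (lam * t / lam), ?_, ?_⟩
    · intro t
      have h₁ := h (lam * t)
      have h₂ := hstep (lam * t)
      simp only [mul_add, mul_one] at h₁ h₂ ⊢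
      linarith
    · intro x
      simp only [mul_div_cancel₀ x hl]
      ring
  · rintro ⟨M, hM, h⟩ x
    have h₁ := hstep x
    rw [h (x + lam), h x]
    have h₂ : M ((x + lam) / lam) = M (x / lam) := by rw [hdiv, hM]
    linarith
end

section
/- Let λ > 0 and let L : ℝ → ℝ satisfy L(t+1) = L(t) for all t. A function G : ℝ → ℝ satisfies G(x+λ) - G(x) = L(x/λ) for all x ∈ ℝ if and only if there is a function M : ℝ → ℝ with M(t+1) = M(t) for all t such that G(x) = λ⁻¹ x L(x/λ) + M(x/λ) for all x ∈ ℝ. -/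
theorem stmt_5 (lam : ℝ) (hlam : 0 < lam)
    (L : ℝ → ℝ) (hL : ∀ t, L (t + 1) = L t) (G : ℝ → ℝ) :
    (∀ x : ℝ, G (x + lam) - G x = L (x / lam)) ↔
      ∃ M : ℝ → ℝ, (∀ t, M (t + 1) = M t) ∧
        ∀ x : ℝ, G x = lam⁻¹ * x * L (x / lam) + M (x / lam) := by
  have hne : lam ≠ 0 := hlam.ne'
  constructor
  · intro h
    refine ⟨fun t => G (lam * t) - t * L t, fun t => ?_, fun x => ?_⟩
    · have h1 := h (lam * t)
      rw [mul_div_cancel_left₀ t hne] at h1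
      simp only [hL, mul_add, mul_one]
      linarith
    · simp only [mul_div_cancel₀ x hne]
      ring
  · rintro ⟨M, hM, h⟩ x
    have hx : (x + lam) / lam = x / lam + 1 := by rw [add_div, div_self hne]
    rw [h (x + lam), h x, hx, hL, hM, mul_add, inv_mul_cancel₀ hne]
    ring
end

section
/- Let a, b, λ > 0 with a + b < 1, let 0 < x₁ < 1 < x₂ be the two roots of a X² - X + b, and set ρ₀ = λ⁻¹ log x₁ < 0. If F : ℝ → ℝ satisfies a F(x+λ) - F(x) + b F(x-λ) = 0 for all x ∈ ℝ, F(x) > 0 for all x, and F(x) → 0 as x → +∞, then there exists a function M : ℝ → ℝ with M(t+1) = M(t) and M(t) > 0 for all t such that F(x) = e^{ρ₀ x} M(x/λ) for all x ∈ ℝ. -/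
/-- A function multiplied by a factor `r ≥ 1` under each translation by `l > 0` vanishes
identically if it tends to `0` at `+∞`. -/
theorem eq_zero_of_translate_eq_mul_of_tendsto_zero {G : ℝ → ℝ} {l r : ℝ} (hl : 0 < l)
    (hr : 1 ≤ r) (hG : ∀ x, G (x + l) = r * G x)
    (hlim : Filter.Tendsto G Filter.atTop (nhds 0)) (x : ℝ) : G x = 0 := by
  have hiter : ∀ n : ℕ, G (x + n * l) = r ^ n * G x := by
    intro n
    induction n with
    | zero => simp
    | succ n ih =>
      rw [show x + ((n + 1 : ℕ) : ℝ) * l = x + n * l + l by push_cast; ring, hG, ih]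
      ring
  have hseq : Filter.Tendsto (fun n : ℕ => |G (x + n * l)|) Filter.atTop (nhds 0) := by
    have h : Filter.Tendsto (fun n : ℕ => x + (n : ℝ) * l) Filter.atTop Filter.atTop :=
      Filter.tendsto_atTop_add_const_left _ x
        (tendsto_natCast_atTop_atTop.atTop_mul_const hl)
    simpa using (hlim.comp h).abs
  have hle : |G x| ≤ 0 := by
    refine ge_of_tendsto' hseq fun n => ?_
    rw [hiter, abs_mul, abs_of_nonneg (pow_nonneg (zero_le_one.trans hr) n)]
    exact le_mul_of_one_le_left (abs_nonneg _) (one_le_pow₀ hr)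
  exact abs_nonpos_iff.mp hle

/-- A decaying solution of the recurrence `a F(x + l) - F(x) + b F(x - l) = 0` is multiplied by the
small characteristic root under translation by `l`. -/
theorem translate_eq_small_root_mul_of_tendsto_zero {a b l x₁ x₂ : ℝ} (ha : a ≠ 0) (hl : 0 < l)
    (hlt : x₁ < x₂) (hx₂ : 1 ≤ x₂)
    (hroot₁ : a * x₁ ^ 2 - x₁ + b = 0) (hroot₂ : a * x₂ ^ 2 - x₂ + b = 0) {F : ℝ → ℝ}
    (hF : ∀ x : ℝ, a * F (x + l) - F x + b * F (x - l) = 0)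
    (hFlim : Filter.Tendsto F Filter.atTop (nhds 0)) (x : ℝ) : F (x + l) = x₁ * F x := by
  have hsum : a * (x₁ + x₂) = 1 := by
    apply mul_left_cancel₀ (sub_ne_zero.mpr hlt.ne)
    linear_combination hroot₁ - hroot₂
  have hprod : b = a * (x₁ * x₂) := by
    linear_combination hroot₁ - x₁ * hsum
  refine sub_eq_zero.mp (eq_zero_of_translate_eq_mul_of_tendsto_zero
    (G := fun y => F (y + l) - x₁ * F y) hl hx₂ (fun y => ?_) ?_ x)
  · have h := hF (y + l)
    rw [add_sub_cancel_right] at h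
    apply mul_left_cancel₀ ha
    linear_combination h - F (y + l) * hsum - F y * hprod
  · have h := hFlim.comp (Filter.tendsto_atTop_add_const_right _ l Filter.tendsto_id)
    simpa using h.sub (hFlim.const_mul x₁)


theorem stmt_8 (a b lam x₁ x₂ ρ₀ : ℝ) (ha : 0 < a) (hb : 0 < b) (hlam : 0 < lam)
    (hab : a + b < 1) (hx₁ : 0 < x₁) (hx₁1 : x₁ < 1) (hx₂ : 1 < x₂)
    (hroot₁ : a * x₁ ^ 2 - x₁ + b = 0) (hroot₂ : a * x₂ ^ 2 - x₂ + b = 0)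
    (hρ₀ : ρ₀ = lam⁻¹ * Real.log x₁)
    (F : ℝ → ℝ)
    (hF : ∀ x : ℝ, a * F (x + lam) - F x + b * F (x - lam) = 0)
    (hFpos : ∀ x, 0 < F x)
    (hFlim : Filter.Tendsto F Filter.atTop (nhds 0)) :
    ∃ M : ℝ → ℝ, (∀ t, M (t + 1) = M t) ∧ (∀ t, 0 < M t) ∧
      ∀ x : ℝ, F x = Real.exp (ρ₀ * x) * M (x / lam) := by
  have htrans := translate_eq_small_root_mul_of_tendsto_zero ha.ne' hlam (hx₁1.trans hx₂) hx₂.le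
    hroot₁ hroot₂ hF hFlim
  have hexp : Real.exp (-(ρ₀ * lam)) * x₁ = 1 := by
    rw [hρ₀, mul_right_comm, inv_mul_cancel₀ hlam.ne', one_mul, Real.exp_neg, Real.exp_log hx₁,
      inv_mul_cancel₀ hx₁.ne']
  refine ⟨fun t => Real.exp (-(ρ₀ * (lam * t))) * F (lam * t), fun t => ?_,
    fun t => mul_pos (Real.exp_pos _) (hFpos _), fun x => ?_⟩
  · dsimp only
    rw [mul_add_one, htrans, show -(ρ₀ * (lam * t + lam)) = -(ρ₀ * (lam * t)) + -(ρ₀ * lam) by ring,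
      Real.exp_add]
    linear_combination Real.exp (-(ρ₀ * (lam * t))) * F (lam * t) * hexp
  · dsimp only
    rw [mul_div_cancel₀ x hlam.ne', ← mul_assoc, ← Real.exp_add, add_neg_cancel, Real.exp_zero,
      one_mul]
end

section
/- Let 0 < p < 1, γ > 0, κ ≥ 1, set a = (1-p)(1+γ)/κ, b = p/(κ(1+γ)), λ = log(1+γ), and let ρ ∈ ℝ be such that (1+γ)^ρ is a root of a X² - X + b. Then for every function M : ℝ → ℝ with M(t+1) = M(t) for all t, the function f(x) = x^{ρ} M(λ⁻¹ log x) on (0,∞) satisfies W_κ(f) = f, where W_κ(f)(x) = (p/(κ(1+γ))) f(x/(1+γ)) + ((1-p)(1+γ)/κ) f((1+γ)x). In particular the Pareto distribution f(x) = C x^{ρ} is a fixed point of W_κ. -/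
theorem stmt_10 (p γ κ : ℝ) (hp0 : 0 < p) (hp1 : p < 1) (hγ : 0 < γ) (hκ : 1 ≤ κ)
    (a b lam ρ : ℝ) (ha : a = (1 - p) * (1 + γ) / κ) (hb : b = p / (κ * (1 + γ)))
    (hlam : lam = Real.log (1 + γ))
    (hroot : a * ((1 + γ) ^ ρ) ^ 2 - (1 + γ) ^ ρ + b = 0) :
    (∀ M : ℝ → ℝ, (∀ t, M (t + 1) = M t) →
      ∀ f : ℝ → ℝ, (∀ x, 0 < x → f x = x ^ ρ * M (lam⁻¹ * Real.log x)) →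
        ∀ x, 0 < x →
          p / (κ * (1 + γ)) * f (x / (1 + γ)) + (1 - p) * (1 + γ) / κ * f ((1 + γ) * x)
            = f x) ∧
    ∀ C : ℝ, ∀ x : ℝ, 0 < x →
      p / (κ * (1 + γ)) * (C * (x / (1 + γ)) ^ ρ)
        + (1 - p) * (1 + γ) / κ * (C * ((1 + γ) * x) ^ ρ) = C * x ^ ρ := by
  have hg : 0 < 1 + γ := by linarith
  rw [← ha, ← hb]
  have power_fixed (C x : ℝ) (hx : 0 < x) :
      b * (C * (x / (1 + γ)) ^ ρ) + a * (C * ((1 + γ) * x) ^ ρ) = C * x ^ ρ := by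
    rw [Real.div_rpow hx.le hg.le, Real.mul_rpow hg.le hx.le]
    field_simp
    linear_combination C * hroot
  refine ⟨fun M hM f hf x hx => ?_, power_fixed⟩
  have hlam0 : lam ≠ 0 := hlam ▸ (Real.log_pos (by linarith)).ne'
  have hup : M (lam⁻¹ * Real.log ((1 + γ) * x)) = M (lam⁻¹ * Real.log x) := by
    rw [Real.log_mul hg.ne' hx.ne', ← hlam, mul_add, inv_mul_cancel₀ hlam0, add_comm, hM]
  have hdown : M (lam⁻¹ * Real.log (x / (1 + γ))) = M (lam⁻¹ * Real.log x) := by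
    rw [Real.log_div hx.ne' hg.ne', ← hlam, mul_sub, inv_mul_cancel₀ hlam0, ← hM,
      sub_add_cancel]
  rw [hf _ (div_pos hx hg), hf _ (mul_pos hg hx), hf x hx, hup, hdown]
  linear_combination power_fixed (M (lam⁻¹ * Real.log x)) x hx
end

section
/- Let 1/2 < p < 1 and γ > 0, and define α(κ) = 1 - log( (κ - √(κ² - 4p(1-p))) / (2(1-p)) ) / log(1+γ) for κ ≥ 1. Then α is strictly increasing in κ on [1, ∞): for 1 ≤ κ < κ' one has α(κ) < α(κ'). -/
/-- The smaller root of `x ^ 2 - 2 * κ * x + c` is positive when `0 < c` and `0 < κ`. -/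
theorem sub_sqrt_sq_sub_pos {c κ : ℝ} (hc : 0 < c) (hκ : 0 < κ) :
    0 < κ - √(κ ^ 2 - c) := by
  rw [sub_pos, Real.sqrt_lt' hκ]
  linarith

/-- The smaller root of `x ^ 2 - 2 * κ * x + c` decreases strictly in `κ`. -/
theorem sub_sqrt_sq_sub_lt {c κ κ' : ℝ} (hc : 0 < c) (hκ : 0 < κ) (hcκ : c ≤ κ ^ 2)
    (h : κ < κ') : κ' - √(κ' ^ 2 - c) < κ - √(κ ^ 2 - c) := by
  have hsq : κ ^ 2 < κ' ^ 2 := by gcongr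
  have hs : √(κ ^ 2 - c) < √(κ' ^ 2 - c) :=
    Real.sqrt_lt_sqrt (by linarith) (by linarith)
  have h1 := Real.sq_sqrt (show 0 ≤ κ ^ 2 - c by linarith)
  have h2 := Real.sq_sqrt (show 0 ≤ κ' ^ 2 - c by linarith)
  have hpos := sub_sqrt_sq_sub_pos hc hκ
  have hnonneg := Real.sqrt_nonneg (κ ^ 2 - c)
  by_contra! hle
  have hlt := mul_lt_mul' hle (add_lt_add h hs) (by linarith) (hpos.trans_le hle)
  nlinarith

theorem stmt_12 (p γ : ℝ) (hp : 1/2 < p) (hp1 : p < 1) (hγ : 0 < γ)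
    (α : ℝ → ℝ)
    (hα : ∀ κ : ℝ, α κ = 1 -
      Real.log ((κ - Real.sqrt (κ ^ 2 - 4 * p * (1 - p))) / (2 * (1 - p)))
        / Real.log (1 + γ)) :
    ∀ κ κ' : ℝ, 1 ≤ κ → κ < κ' → α κ < α κ' := by
  intro κ κ' hκ h
  have hq : 0 < 1 - p := by linarith
  have hc : 0 < 4 * p * (1 - p) := mul_pos (by linarith) hq
  have hcκ : 4 * p * (1 - p) ≤ κ ^ 2 := by nlinarith [sq_nonneg (2 * p - 1)]
  have hlog : 0 < Real.log (1 + γ) := Real.log_pos (by linarith)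
  have hpos := sub_sqrt_sq_sub_pos hc (show 0 < κ' by linarith)
  have hlt := sub_sqrt_sq_sub_lt hc (show 0 < κ by linarith) hcκ h
  rw [hα, hα]
  gcongr
end

section
/- Let 1/2 < p < 1 and κ > 1, and define α(γ) = 1 - log( (κ - √(κ² - 4p(1-p))) / (2(1-p)) ) / log(1+γ) for γ > 0. Then α is strictly decreasing in γ on (0, ∞): for 0 < γ < γ' one has α(γ) > α(γ'). -/
theorem log_ratio_neg {p κ : ℝ} (hp : 0 < p) (hp1 : p < 1) (hκ : 1 < κ) :
    Real.log ((κ - Real.sqrt (κ ^ 2 - 4 * p * (1 - p))) / (2 * (1 - p))) < 0 := by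
  have hq : 0 < 1 - p := sub_pos.mpr hp1
  have hpq : 0 < p * (1 - p) := mul_pos hp hq
  have hlt : Real.sqrt (κ ^ 2 - 4 * p * (1 - p)) < κ := by
    rw [Real.sqrt_lt' (by linarith)]
    linarith
  have hgt : κ - 2 * (1 - p) < Real.sqrt (κ ^ 2 - 4 * p * (1 - p)) := by
    apply Real.lt_sqrt_of_sq_lt
    nlinarith [mul_pos hq (sub_pos.mpr hκ)]
  apply Real.log_neg
  · exact div_pos (by linarith) (by linarith)
  · rw [div_lt_one (by linarith)]
    linarith

theorem stmt_13 (p κ : ℝ) (hp : 1/2 < p) (hp1 : p < 1) (hκ : 1 < κ)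
    (α : ℝ → ℝ)
    (hα : ∀ γ : ℝ, α γ = 1 -
      Real.log ((κ - Real.sqrt (κ ^ 2 - 4 * p * (1 - p))) / (2 * (1 - p)))
        / Real.log (1 + γ)) :
    ∀ γ γ' : ℝ, 0 < γ → γ < γ' → α γ' < α γ := by
  intro γ γ' hγ hγγ'
  have hL := log_ratio_neg (by linarith : 0 < p) hp1 hκ
  have hlog : 0 < Real.log (1 + γ) := Real.log_pos (by linarith)
  have hlog_lt : Real.log (1 + γ) < Real.log (1 + γ') :=
    Real.log_lt_log (by linarith) (by linarith)
  rw [hα, hα]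
  have := div_lt_div_of_pos_left (neg_pos.mpr hL) hlog hlog_lt
  rw [neg_div, neg_div] at this
  linarith
end

section
/- Let 1/2 < p < 1, γ > 0, κ ≥ 1, let α = 1 - log( (κ - √(κ² - 4p(1-p))) / (2(1-p)) ) / log(1+γ) be the Pareto exponent, let M : ℝ → ℝ be continuous with M(t+1) = M(t) and M(t) > 0 for all t, and let f(x) = x^{-α} M(log x / log(1+γ)) for x > 0. Then for any x₀ > 0 the following three conditions are equivalent: (1) the tail wealth is summable, i.e. ∫_{x₀}^{∞} f(x) dx < ∞; (2) α > 1; (3) κ > 1. -/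
open MeasureTheory

/-- A continuous positive function on `ℝ` of period one is bounded between positive constants. -/
theorem exists_pos_bounds_of_periodic_one {M : ℝ → ℝ} (hM : Continuous M)
    (hper : Function.Periodic M 1) (hpos : ∀ t, 0 < M t) :
    ∃ m C : ℝ, 0 < m ∧ ∀ t, m ≤ M t ∧ M t ≤ C := by
  have hne : (Set.Icc (0 : ℝ) 1).Nonempty := ⟨0, by simp⟩
  obtain ⟨a, -, ha⟩ := isCompact_Icc.exists_isMinOn hne hM.continuousOn
  obtain ⟨b, -, hb⟩ := isCompact_Icc.exists_isMaxOn hne hM.continuousOn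
  refine ⟨M a, M b, hpos a, fun t => ?_⟩
  obtain ⟨y, hy, hty⟩ := hper.exists_mem_Ico₀ one_pos t
  rw [hty]
  exact ⟨ha (Set.Ico_subset_Icc_self hy), hb (Set.Ico_subset_Icc_self hy)⟩

/-- A power of `x` modulated by a factor bounded between positive constants is integrable at
infinity exactly when the power is. -/
theorem integrableOn_Ioi_rpow_mul_iff {s x₀ m C : ℝ} {g : ℝ → ℝ} (hx₀ : 0 < x₀) (hm : 0 < m)
    (hg : Measurable g) (hgm : ∀ x, m ≤ g x) (hgC : ∀ x, g x ≤ C) :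
    IntegrableOn (fun x => x ^ s * g x) (Set.Ioi x₀) ↔ s < -1 := by
  rw [← integrableOn_Ioi_rpow_iff hx₀]
  have hpow : Measurable fun x : ℝ => x ^ s := measurable_id.pow_const s
  constructor
  · intro h
    refine (h.const_mul m⁻¹).mono' hpow.aestronglyMeasurable ?_
    filter_upwards [ae_restrict_mem measurableSet_Ioi] with x hx
    have hx0 : 0 ≤ x ^ s := Real.rpow_nonneg (hx₀.trans hx).le s
    rw [Real.norm_of_nonneg hx0, inv_mul_eq_div, le_div_iff₀ hm]
    exact mul_le_mul_of_nonneg_left (hgm x) hx0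
  · intro h
    refine (h.mul_const C).mono' (hpow.mul hg).aestronglyMeasurable ?_
    filter_upwards [ae_restrict_mem measurableSet_Ioi] with x hx
    have hx0 : 0 ≤ x ^ s := Real.rpow_nonneg (hx₀.trans hx).le s
    rw [Real.norm_of_nonneg (mul_nonneg hx0 (hm.le.trans (hgm x)))]
    exact mul_le_mul_of_nonneg_left (hgC x) hx0

/-- The smaller root of `(1 - p) z ^ 2 - κ z + p` is positive. -/
theorem smaller_root_pos {p κ : ℝ} (hp : 0 < p) (hp1 : p < 1) (hκ : 0 < κ) :
    0 < (κ - √(κ ^ 2 - 4 * p * (1 - p))) / (2 * (1 - p)) := by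
  have hq : 0 < 1 - p := sub_pos.2 hp1
  refine div_pos (sub_pos.2 ?_) (by positivity)
  rw [Real.sqrt_lt' hκ]
  nlinarith [mul_pos hp hq]

/-- The smaller root of `(1 - p) z ^ 2 - κ z + p` is less than one exactly when `1 < κ`. -/
theorem smaller_root_lt_one_iff {p κ : ℝ} (hp : 1 / 2 < p) (hp1 : p < 1) (hκ : 1 ≤ κ) :
    (κ - √(κ ^ 2 - 4 * p * (1 - p))) / (2 * (1 - p)) < 1 ↔ 1 < κ := by
  have hq : 0 < 1 - p := sub_pos.2 hp1
  rw [div_lt_one (by positivity), sub_lt_comm, Real.lt_sqrt (by linarith)]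
  have key : κ ^ 2 - 4 * p * (1 - p) - (κ - 2 * (1 - p)) ^ 2 = 4 * (1 - p) * (κ - 1) := by ring
  rw [← sub_pos, key, mul_pos_iff_of_pos_left (by positivity), sub_pos]

theorem stmt_15 (p γ κ : ℝ) (hp : 1/2 < p) (hp1 : p < 1) (hγ : 0 < γ) (hκ : 1 ≤ κ)
    (α : ℝ)
    (hα : α = 1 - Real.log ((κ - Real.sqrt (κ ^ 2 - 4 * p * (1 - p))) / (2 * (1 - p)))
        / Real.log (1 + γ))
    (M : ℝ → ℝ) (hMcont : Continuous M) (hMper : ∀ t, M (t + 1) = M t)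
    (hMpos : ∀ t, 0 < M t)
    (f : ℝ → ℝ) (hf : ∀ x, 0 < x → f x = x ^ (-α) * M (Real.log x / Real.log (1 + γ)))
    (x₀ : ℝ) (hx₀ : 0 < x₀) :
    (IntegrableOn f (Set.Ioi x₀) ↔ 1 < α) ∧ (1 < α ↔ 1 < κ) := by
  constructor
  · obtain ⟨m, C, hm, hMb⟩ := exists_pos_bounds_of_periodic_one hMcont hMper hMpos
    have hmeas : Measurable fun x => M (Real.log x / Real.log (1 + γ)) :=
      hMcont.measurable.comp (Real.measurable_log.div_const _)
    rw [integrableOn_congr_fun (s := Set.Ioi x₀) (fun x hx => hf x (hx₀.trans hx)) measurableSet_Ioi,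
      integrableOn_Ioi_rpow_mul_iff hx₀ hm hmeas (fun x => (hMb _).1) (fun x => (hMb _).2),
      neg_lt_neg_iff]
  · have hlog : 0 < Real.log (1 + γ) := Real.log_pos (by linarith)
    rw [hα, lt_sub_comm, sub_self, div_lt_iff₀ hlog, zero_mul,
      Real.log_neg_iff (smaller_root_pos (by linarith) hp1 (by linarith)),
      smaller_root_lt_one_iff hp hp1 hκ]
end

section
/- Let 0 < p < 1, γ > 0, κ ≥ 1, and let f, g : (0,∞) → ℝ be measurable functions with f - g ∈ L¹((0,∞)) (with respect to Lebesgue measure). Then W_κ(f) - W_κ(g) ∈ L¹((0,∞)) and ‖W_κ(f) - W_κ(g)‖_{L¹} ≤ κ⁻¹ ‖f - g‖_{L¹}. -/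
open MeasureTheory

theorem stmt_16 (p γ κ : ℝ) (hp0 : 0 < p) (hp1 : p < 1) (hγ : 0 < γ) (hκ : 1 ≤ κ)
    (W : (ℝ → ℝ) → (ℝ → ℝ))
    (hW : ∀ f : ℝ → ℝ, ∀ x : ℝ, W f x =
      p / (κ * (1 + γ)) * f (x / (1 + γ)) + (1 - p) * (1 + γ) / κ * f ((1 + γ) * x))
    (f g : ℝ → ℝ) (hfm : Measurable f) (hgm : Measurable g)
    (hfg : IntegrableOn (fun x => f x - g x) (Set.Ioi 0)) :
    IntegrableOn (fun x => W f x - W g x) (Set.Ioi 0) ∧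
    ∫ x in Set.Ioi (0:ℝ), |W f x - W g x| ≤ κ⁻¹ * ∫ x in Set.Ioi (0:ℝ), |f x - g x| := by
  have hc : 0 < 1 + γ := by linarith
  have hκ0 : 0 < κ := by linarith
  set c := 1 + γ
  set h : ℝ → ℝ := fun x => f x - g x with hh
  have hscale (b : ℝ) (hb : 0 < b) : IntegrableOn (fun x => h (b * x)) (Set.Ioi 0) := by
    rw [integrableOn_Ioi_comp_mul_left_iff h 0 hb, mul_zero]
    exact hfg
  have hnorm (b : ℝ) (hb : 0 < b) :
      ∫ x in Set.Ioi (0:ℝ), |h (b * x)| = b⁻¹ * ∫ x in Set.Ioi (0:ℝ), |h x| := by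
    simpa using integral_comp_mul_left_Ioi (fun x => |h x|) 0 hb
  have hWh (x : ℝ) : W f x - W g x =
      p / (κ * c) * h (c⁻¹ * x) + (1 - p) * c / κ * h (c * x) := by
    simp only [hW, hh, div_eq_inv_mul x c]
    ring
  have hint₁ := (hscale c⁻¹ (inv_pos.2 hc)).const_mul (p / (κ * c))
  have hint₂ := (hscale c hc).const_mul ((1 - p) * c / κ)
  have habs₁ := (hscale c⁻¹ (inv_pos.2 hc)).abs.const_mul (p / (κ * c))
  have habs₂ := (hscale c hc).abs.const_mul ((1 - p) * c / κ)
  have hp₁ : 0 ≤ p / (κ * c) := by positivity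
  have hp₂ : 0 ≤ (1 - p) * c / κ := by
    have : 0 < 1 - p := by linarith
    positivity
  simp only [hWh]
  refine ⟨hint₁.add hint₂, ?_⟩
  calc ∫ x in Set.Ioi (0:ℝ), |p / (κ * c) * h (c⁻¹ * x) + (1 - p) * c / κ * h (c * x)|
      ≤ ∫ x in Set.Ioi (0:ℝ),
          (p / (κ * c) * |h (c⁻¹ * x)| + (1 - p) * c / κ * |h (c * x)|) := by
        refine integral_mono (hint₁.add hint₂).abs (habs₁.add habs₂) fun x => ?_
        refine (abs_add_le _ _).trans_eq ?_
        simp only [abs_mul, abs_of_nonneg hp₁, abs_of_nonneg hp₂]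
    _ = κ⁻¹ * ∫ x in Set.Ioi (0:ℝ), |h x| := by
        rw [integral_add habs₁ habs₂, integral_const_mul, integral_const_mul,
          hnorm c⁻¹ (inv_pos.2 hc), hnorm c hc]
        field_simp
        ring
end

section
/- Let 0 < p < 1, γ > 0, κ > 1, let f₀ : (0,∞) → ℝ be a measurable fixed point of the wealth evolution operator, W_κ(f₀) = f₀, and let g : (0,∞) → ℝ be measurable with g - f₀ ∈ L¹((0,∞)). Then for every n ≥ 0, ‖W_κⁿ(g) - f₀‖_{L¹} ≤ κ^{-n} ‖g - f₀‖_{L¹}; in particular W_κⁿ(g) → f₀ in L¹ norm at a geometric rate. Hence f₀ is a global attractor in the set S_{f₀} = { g measurable : ‖g - f₀‖_{L¹} < ∞ }. -/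
open MeasureTheory

theorem integrableOn_Ioi_zero_comp_mul_left {h : ℝ → ℝ} (hh : IntegrableOn h (Set.Ioi 0))
    {c : ℝ} (hc : 0 < c) : IntegrableOn (fun x => h (c * x)) (Set.Ioi 0) := by
  rw [integrableOn_Ioi_comp_mul_left_iff h 0 hc, mul_zero]
  exact hh

theorem integrableOn_wealth_step (a b : ℝ) {c : ℝ} (hc : 0 < c) {h : ℝ → ℝ}
    (hh : IntegrableOn h (Set.Ioi 0)) :
    IntegrableOn (fun x => a * h (x / c) + b * h (c * x)) (Set.Ioi 0) := by
  simp only [div_eq_inv_mul]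
  exact ((integrableOn_Ioi_zero_comp_mul_left hh (inv_pos.2 hc)).const_mul a).add
    ((integrableOn_Ioi_zero_comp_mul_left hh hc).const_mul b)

theorem integral_abs_wealth_step_le {a b c : ℝ} (ha : 0 ≤ a) (hb : 0 ≤ b) (hc : 0 < c)
    {h : ℝ → ℝ} (hh : IntegrableOn h (Set.Ioi 0)) :
    ∫ x in Set.Ioi (0 : ℝ), |a * h (x / c) + b * h (c * x)|
      ≤ (a * c + b / c) * ∫ x in Set.Ioi (0 : ℝ), |h x| := by
  have habs : IntegrableOn (fun x => |h x|) (Set.Ioi 0) := hh.abs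
  have h₁ := (integrableOn_Ioi_zero_comp_mul_left habs (inv_pos.2 hc)).const_mul a
  have h₂ := (integrableOn_Ioi_zero_comp_mul_left habs hc).const_mul b
  calc ∫ x in Set.Ioi (0 : ℝ), |a * h (x / c) + b * h (c * x)|
      ≤ ∫ x in Set.Ioi (0 : ℝ), (a * |h (c⁻¹ * x)| + b * |h (c * x)|) := by
        refine integral_mono (integrableOn_wealth_step a b hc hh).abs (h₁.add h₂) fun x => ?_
        refine (abs_add_le _ _).trans_eq ?_
        simp only [abs_mul, abs_of_nonneg ha, abs_of_nonneg hb, div_eq_inv_mul]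
    _ = (a * c + b / c) * ∫ x in Set.Ioi (0 : ℝ), |h x| := by
        rw [integral_add h₁ h₂, integral_const_mul, integral_const_mul,
          integral_comp_mul_left_Ioi (fun x => |h x|) 0 (inv_pos.2 hc),
          integral_comp_mul_left_Ioi (fun x => |h x|) 0 hc]
        simp only [mul_zero, inv_inv, smul_eq_mul]
        ring

theorem stmt_18 (p γ κ : ℝ) (hp0 : 0 < p) (hp1 : p < 1) (hγ : 0 < γ) (hκ : 1 < κ)
    (W : (ℝ → ℝ) → (ℝ → ℝ))
    (hW : ∀ f : ℝ → ℝ, ∀ x : ℝ, W f x =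
      p / (κ * (1 + γ)) * f (x / (1 + γ)) + (1 - p) * (1 + γ) / κ * f ((1 + γ) * x))
    (f₀ : ℝ → ℝ) (hf₀m : Measurable f₀) (hfix : W f₀ = f₀)
    (g : ℝ → ℝ) (hgm : Measurable g)
    (hgf₀ : IntegrableOn (fun x => g x - f₀ x) (Set.Ioi 0)) :
    (∀ n : ℕ, IntegrableOn (fun x => W^[n] g x - f₀ x) (Set.Ioi 0) ∧
      ∫ x in Set.Ioi (0:ℝ), |W^[n] g x - f₀ x|
        ≤ (κ⁻¹) ^ n * ∫ x in Set.Ioi (0:ℝ), |g x - f₀ x|) ∧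
    Filter.Tendsto (fun n : ℕ => ∫ x in Set.Ioi (0:ℝ), |W^[n] g x - f₀ x|)
      Filter.atTop (nhds 0) := by
  have hc : 0 < 1 + γ := by linarith
  have hκ0 : 0 < κ := by linarith
  have ha : 0 ≤ p / (κ * (1 + γ)) := by positivity
  have hb : 0 ≤ (1 - p) * (1 + γ) / κ :=
    div_nonneg (mul_nonneg (by linarith) hc.le) hκ0.le
  have hsum : p / (κ * (1 + γ)) * (1 + γ) + (1 - p) * (1 + γ) / κ / (1 + γ) = κ⁻¹ := by
    field_simp
    ring
  have hdiff : ∀ f x, W f x - f₀ x =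
      p / (κ * (1 + γ)) * (f (x / (1 + γ)) - f₀ (x / (1 + γ))) +
        (1 - p) * (1 + γ) / κ * (f ((1 + γ) * x) - f₀ ((1 + γ) * x)) := by
    intro f x
    have hx := congrFun hfix x
    rw [hW] at hx
    rw [hW]
    linear_combination hx
  have hmain : ∀ n : ℕ, IntegrableOn (fun x => W^[n] g x - f₀ x) (Set.Ioi 0) ∧
      ∫ x in Set.Ioi (0:ℝ), |W^[n] g x - f₀ x|
        ≤ (κ⁻¹) ^ n * ∫ x in Set.Ioi (0:ℝ), |g x - f₀ x| := by
    intro n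
    induction n with
    | zero => simpa using hgf₀
    | succ n ih =>
      obtain ⟨hint, hle⟩ := ih
      simp only [Function.iterate_succ_apply', hdiff]
      refine ⟨integrableOn_wealth_step _ _ hc hint,
        (integral_abs_wealth_step_le ha hb hc hint).trans ?_⟩
      rw [hsum, pow_succ', mul_assoc]
      gcongr
  refine ⟨hmain, squeeze_zero (fun n => integral_nonneg fun x => abs_nonneg _)
    (fun n => (hmain n).2) ?_⟩
  simpa using (tendsto_pow_atTop_nhds_zero_of_lt_one (inv_nonneg.2 hκ0.le)
    (inv_lt_one_of_one_lt₀ hκ)).mul_const (∫ x in Set.Ioi (0:ℝ), |g x - f₀ x|)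
end
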